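/- Let n, m, N, M be positive integers with m ≥ 2, N ≤ M and M dividing n. Let q be the max-scaled INT_m quantization on ℝⁿ, let x ∈ ℝⁿ, and let P be an N:M magnitude sparsity mask for x with associated sparsification s. Define the correction error vector of the composition q ∘ s by ε̃(x) := (x − q(s(x))) − (x − q(x)) − (x − s(x)). Then ε̃(x)_i = −(x_i − q(x)_i) for every pruned index i ∈ P, and ε̃(x)_i = 0 for every retained index i ∉ P; that is, when sparsity precedes quantization the correction vector consists exclusively of the negated quantization errors of the pruned elements. -/

import Mathlib

/-- Max-scaled INT_m quantization on ℝⁿ: `q(x)_i = δ(x) * round (x_i / δ(x))` where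
`δ(x) = (max_j |x_j|) / (2^(m-1) - 1)`. (For `x = 0` this yields `q 0 = 0`.) -/
noncomputable def qInt (m : ℕ) {n : ℕ} (x : Fin n → ℝ) : Fin n → ℝ :=
  fun i =>
    let δ : ℝ := (⨆ j, |x j|) / ((2 : ℝ) ^ (m - 1) - 1)
    δ * (round (x i / δ) : ℝ)

/-- `P` is an N:M magnitude sparsity mask for `v`: each consecutive group of `M`
coordinates (indices with a common value of `i / M`) contains exactly `M - N` pruned
indices, and within each group every pruned coordinate has magnitude at most that of
every retained coordinate. -/
def IsNMMask {n : ℕ} (N M : ℕ) (v : Fin n → ℝ) (P : Finset (Fin n)) : Prop :=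
  (∀ g : ℕ, g < n / M → (P.filter fun i : Fin n => (i : ℕ) / M = g).card = M - N) ∧
  (∀ i ∈ P, ∀ j : Fin n, j ∉ P → (i : ℕ) / M = (j : ℕ) / M → |v i| ≤ |v j|)

/-- Sparsification associated with a mask `P`: coordinates in `P` are set to `0`,
the others are left unchanged. -/
def sparsify {n : ℕ} (P : Finset (Fin n)) (v : Fin n → ℝ) : Fin n → ℝ :=
  fun i => if i ∈ P then 0 else v i

/-- The `L_p` norm `(∑ i, |v i| ^ p) ^ (1/p)` on `ℝⁿ`. -/
noncomputable def lpNorm {n : ℕ} (p : ℝ) (v : Fin n → ℝ) : ℝ :=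
  (∑ i, |v i| ^ p) ^ (1 / p)

theorem exists_retained_aux {n N M : ℕ} (hN : 0 < N) (hNM : N ≤ M) (hMdvd : M ∣ n)
    (x : Fin n → ℝ) (P : Finset (Fin n)) (hP : IsNMMask N M x P) (i : Fin n) :
    ∃ j : Fin n, j ∉ P ∧ (i : ℕ) / M = (j : ℕ) / M := by
  by_contra! hcon
  have hM : 0 < M := by omega
  have hg : (i : ℕ) / M < n / M := Nat.div_lt_div_of_lt_of_dvd hMdvd i.2
  have hc := hP.1 _ hg
  have hb : ∀ k : Fin M, (i : ℕ) / M * M + k < n := by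
    intro k
    have h1 : ((i : ℕ) / M + 1) * M ≤ n / M * M := Nat.mul_le_mul_right _ hg
    rw [Nat.div_mul_cancel hMdvd] at h1
    have := k.2
    rw [add_mul] at h1
    omega
  have hle := Finset.card_le_card_of_injOn (s := (Finset.univ : Finset (Fin M)))
    (t := P.filter fun l : Fin n => (l : ℕ) / M = (i : ℕ) / M)
    (fun k => (⟨(i : ℕ) / M * M + k, hb k⟩ : Fin n))
    (by
      intro k _
      have hd : ((i : ℕ) / M * M + k) / M = (i : ℕ) / M := by
        rw [mul_comm, Nat.mul_add_div hM, Nat.div_eq_of_lt k.2, add_zero]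
      simp only [Finset.coe_filter, Set.mem_setOf_eq]
      refine ⟨?_, hd⟩
      by_contra hk
      exact hcon _ hk hd.symm)
    (by
      intro a _ b _ hab
      simp only [Fin.mk.injEq] at hab
      exact Fin.ext (by omega))
  rw [hc, Finset.card_univ, Fintype.card_fin] at hle
  omega

theorem iSup_sparsify_aux {n N M : ℕ} (hn : 0 < n) (hN : 0 < N) (hNM : N ≤ M) (hMdvd : M ∣ n)
    (x : Fin n → ℝ) (P : Finset (Fin n)) (hP : IsNMMask N M x P) :
    (⨆ j, |sparsify P x j|) = ⨆ j, |x j| := by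
  haveI : Nonempty (Fin n) := ⟨⟨0, hn⟩⟩
  apply le_antisymm
  · refine ciSup_le fun i => ?_
    refine le_trans ?_ (le_ciSup (Set.finite_range fun j => |x j|).bddAbove i)
    unfold sparsify
    split_ifs <;> simp
  · refine ciSup_le fun i => ?_
    have key : ∀ j, j ∉ P → |x j| ≤ ⨆ j, |sparsify P x j| := by
      intro j hj
      have := le_ciSup (Set.finite_range fun j => |sparsify P x j|).bddAbove j
      simpa [sparsify, hj] using this
    by_cases hi : i ∈ P
    · obtain ⟨j, hj, hij⟩ := exists_retained_aux hN hNM hMdvd x P hP i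
      exact (hP.2 i hi j hj hij).trans (key j hj)
    · exact key i hi

/-- When sparsity precedes quantization, the correction error vector
`ε̃(x) = ε_{q∘s}(x) − ε_q(x) − ε_s(x)` consists exclusively of the negated
quantization errors of the pruned elements. -/
theorem correction_vector_of_sparsity_then_quantization
    (n m N M : ℕ) (hn : 0 < n) (hm : 2 ≤ m) (hN : 0 < N) (hNM : N ≤ M) (hMdvd : M ∣ n)
    (x : Fin n → ℝ) (P : Finset (Fin n)) (hP : IsNMMask N M x P) :
    ∀ i : Fin n,
      (i ∈ P →
        ((x - qInt m (sparsify P x)) - (x - qInt m x) - (x - sparsify P x)) i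
          = -(x i - qInt m x i)) ∧
      (i ∉ P →
        ((x - qInt m (sparsify P x)) - (x - qInt m x) - (x - sparsify P x)) i = 0) := by
  intro i
  have hs := iSup_sparsify_aux hn hN hNM hMdvd x P hP
  constructor
  · intro hi
    have h0 : sparsify P x i = 0 := by simp [sparsify, hi]
    have h1 : qInt m (sparsify P x) i = 0 := by simp [qInt, h0]
    simp only [Pi.sub_apply, h0, h1]
    ring
  · intro hi
    have h0 : sparsify P x i = x i := by simp [sparsify, hi]
    have h1 : qInt m (sparsify P x) i = qInt m x i := by simp only [qInt, h0, hs]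
    simp only [Pi.sub_apply, h0, h1]
    ring
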